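/- In the n-spin generalized Hopfield model with N neurons and M i.i.d. uniform patterns, for every t > 0 the probability that the first pattern is not a fixed point of the dynamics satisfies the exponential Chebyshev bound: P(∃ i ≤ N : T̂_i(ξ^1) ≠ ξ^1_i) ≤ N · exp(−t N^{n-1}) · E[ exp( −t ξ^1_1 ξ^2_1 ( Σ_{j=1}^N ξ^1_j ξ^2_j )^{n-1} ) ]^{M-1} ≤ N · exp(−t N^{n-1}) · E[ cosh( t ( Σ_{j=1}^N ξ^1_j ξ^2_j )^{n-1} ) ]^{M-1}. -/

import Mathlib

open Finset

/-- Map a Boolean to the corresponding `±1` spin value. -/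
noncomputable def pm (b : Bool) : ℝ := if b then 1 else -1

open Classical in
/-- Probability of an event `E` under the uniform distribution on a finite type `Ω`. -/
noncomputable def unifProb {Ω : Type*} [Fintype Ω] (E : Ω → Prop) : ℝ :=
  ((Finset.univ.filter E).card : ℝ) / (Fintype.card Ω : ℝ)

/-- Expectation of a function of two independent uniform patterns `ξ^1, ξ^2` in
`{-1,+1}^N`. -/
noncomputable def expect2 (N : ℕ) (f : (Fin N → Bool) → (Fin N → Bool) → ℝ) : ℝ :=
  (∑ a : Fin N → Bool, ∑ b : Fin N → Bool, f a b) /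
    ((Fintype.card (Fin N → Bool) : ℝ) * (Fintype.card (Fin N → Bool) : ℝ))

/-- One step of the `n`-spin retrieval dynamics of the generalized Hopfield model with
patterns `ξ^1, …, ξ^M`, evaluated at neuron `i` of the configuration `σ`:
`T̂_i(σ) = sgn(Σ_{j_1,…,j_{n-1}} σ_{j_1} ⋯ σ_{j_{n-1}} W_{i,j_1,…,j_{n-1}})` with the
`n`-spin synaptic weights `W_{i_1,…,i_n} = N^{-(n-1)} Σ_μ ξ_{i_1}^μ ⋯ ξ_{i_n}^μ`. -/
noncomputable def hopT (n : ℕ) {M N : ℕ} (ξ : Fin M → Fin N → ℝ) (σ : Fin N → ℝ)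
    (i : Fin N) : ℝ :=
  Real.sign (∑ jv : Fin (n - 1) → Fin N,
    (∏ l, σ (jv l)) * (((N : ℝ) ^ (n - 1))⁻¹ * ∑ μ, ξ μ i * ∏ l, ξ μ (jv l)))

lemma pm_sq (b : Bool) : pm b * pm b = 1 := by cases b <;> simp [pm]

lemma pm_mul (a b : Bool) : pm a * pm b = pm (a == b) := by
  cases a <;> cases b <;> simp [pm]

lemma pm_not (b : Bool) : pm (!b) = - pm b := by cases b <;> simp [pm]

/-- XNOR with a fixed pattern, as an equivalence. -/
def xnorEquiv {N : ℕ} (a : Fin N → Bool) : (Fin N → Bool) ≃ (Fin N → Bool) where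
  toFun b := fun j => a j == b j
  invFun b := fun j => a j == b j
  left_inv b := by funext j; simp
  right_inv b := by funext j; simp

/-- global flip -/
def flipEquiv (N : ℕ) : (Fin N → Bool) ≃ (Fin N → Bool) where
  toFun b := fun j => !(b j)
  invFun b := fun j => !(b j)
  left_inv b := by funext j; simp
  right_inv b := by funext j; simp

noncomputable def gE {N : ℕ} (t : ℝ) (k : ℕ) (i : Fin N) (x : Fin N → Bool) : ℝ :=
  Real.exp (-t * pm (x i) * (∑ j, pm (x j)) ^ k)

lemma sum_xnor {N : ℕ} (a : Fin N → Bool) (F : (Fin N → Bool) → ℝ) :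
    ∑ b : Fin N → Bool, F (fun j => a j == b j) = ∑ x, F x :=
  Equiv.sum_comp (xnorEquiv a) F

lemma gE_sym {N : ℕ} (t : ℝ) (k : ℕ) (i i' : Fin N) :
    ∑ x, gE t k i x = ∑ x, gE t k i' x := by
  rw [← Equiv.sum_comp ((Equiv.swap i i').arrowCongr (Equiv.refl Bool)) (gE t k i')]
  refine Finset.sum_congr rfl fun x _ => ?_
  have h : ∑ j, pm (x ((Equiv.swap i i') j)) = ∑ j, pm (x j) :=
    Equiv.sum_comp (Equiv.swap i i') (fun j => pm (x j))
  simp [gE, Equiv.arrowCongr, h]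

lemma expect2_eq {N : ℕ} (F : (Fin N → Bool) → ℝ) :
    expect2 N (fun a b => F (fun j => a j == b j)) =
      (∑ x, F x) / (Fintype.card (Fin N → Bool) : ℝ) := by
  unfold expect2
  simp only [sum_xnor]
  rw [Finset.sum_const, Finset.card_univ, nsmul_eq_mul]
  have : (Fintype.card (Fin N → Bool) : ℝ) ≠ 0 := by positivity
  field_simp

lemma exp_pm (b : Bool) (t A : ℝ) :
    Real.exp (-t * pm b * A) = Real.cosh (t * A) - pm b * Real.sinh (t * A) := by
  cases b
  · simp [pm, Real.cosh_add_sinh]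
  · simp [pm, Real.cosh_sub_sinh]

lemma sum_S_sinh {N : ℕ} (t : ℝ) (ht : 0 < t) (k : ℕ) :
    0 ≤ ∑ x : Fin N → Bool, (∑ j, pm (x j)) * Real.sinh (t * (∑ j, pm (x j)) ^ k) := by
  rcases Nat.even_or_odd k with hk | hk
  · have h := Equiv.sum_comp (flipEquiv N)
      (fun x => (∑ j, pm (x j)) * Real.sinh (t * (∑ j, pm (x j)) ^ k))
    simp only [flipEquiv, Equiv.coe_fn_mk, pm_not, Finset.sum_neg_distrib, hk.neg_pow,
      neg_mul] at h
    linarith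
  · refine Finset.sum_nonneg fun x _ => ?_
    generalize (∑ j, pm (x j)) = S
    rcases le_total 0 S with h | h
    · exact mul_nonneg h (Real.sinh_nonneg_iff.2 (by positivity))
    · exact mul_nonneg_of_nonpos_of_nonpos h
        (Real.sinh_nonpos_iff.2 (mul_nonpos_of_nonneg_of_nonpos ht.le (hk.pow_nonpos h)))

lemma sum_gE_le {N : ℕ} [NeZero N] (t : ℝ) (ht : 0 < t) (k : ℕ) :
    ∑ x : Fin N → Bool, gE t k 0 x ≤
      ∑ x : Fin N → Bool, Real.cosh (t * (∑ j, pm (x j)) ^ k) := by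
  have hN : (0 : ℝ) < N := by exact_mod_cast Nat.pos_of_ne_zero (NeZero.ne N)
  have h1 : (N : ℝ) * ∑ x : Fin N → Bool, gE t k 0 x = ∑ i : Fin N, ∑ x, gE t k i x := by
    rw [Finset.sum_congr rfl fun i _ => gE_sym t k i 0]; simp
  have h2 : ∑ i : Fin N, ∑ x, gE t k i x =
      (N : ℝ) * (∑ x : Fin N → Bool, Real.cosh (t * (∑ j, pm (x j)) ^ k)) -
      ∑ x : Fin N → Bool, (∑ j, pm (x j)) * Real.sinh (t * (∑ j, pm (x j)) ^ k) := by
    rw [Finset.sum_comm, Finset.mul_sum, ← Finset.sum_sub_distrib]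
    refine Finset.sum_congr rfl fun x _ => ?_
    simp only [gE, exp_pm]
    rw [Finset.sum_sub_distrib, Finset.sum_mul]; simp
  have h3 := sum_S_sinh (N := N) t ht k
  have : (N : ℝ) * ∑ x : Fin N → Bool, gE t k 0 x ≤ 
    (N : ℝ) * (∑ x : Fin N → Bool, Real.cosh (t * (∑ j, pm (x j)) ^ k)) := by linarith
  exact le_of_mul_le_mul_left this hN

lemma hop_field {M N : ℕ} (k : ℕ) (ξ : Fin M → Fin N → ℝ) (σ : Fin N → ℝ) (i : Fin N) :
    (∑ jv : Fin k → Fin N,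
      (∏ l, σ (jv l)) * (((N : ℝ) ^ k)⁻¹ * ∑ μ, ξ μ i * ∏ l, ξ μ (jv l))) =
    ((N : ℝ) ^ k)⁻¹ * ∑ μ, ξ μ i * (∑ j, σ j * ξ μ j) ^ k := by
  simp only [Fintype.sum_pow, Finset.mul_sum, Finset.prod_mul_distrib]
  rw [Finset.sum_comm]
  refine Finset.sum_congr rfl fun μ _ => Finset.sum_congr rfl fun jv _ => ?_
  ring

lemma sign_ne {b : Bool} {h : ℝ} (H : Real.sign h ≠ pm b) : pm b * h ≤ 0 := by
  by_contra hc
  push Not at hc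
  apply H
  cases b
  · simp [pm] at hc ⊢; exact Real.sign_of_neg hc
  · simp [pm] at hc ⊢; exact Real.sign_of_pos hc

lemma event_le {m N : ℕ} [NeZero N] (k : ℕ) (t : ℝ) (ht : 0 < t)
    (ω : Fin (m + 1) → Fin N → Bool) (i : Fin N)
    (H : Real.sign (∑ jv : Fin k → Fin N, (∏ l, pm (ω 0 (jv l))) *
      (((N : ℝ) ^ k)⁻¹ * ∑ μ, pm (ω μ i) * ∏ l, pm (ω μ (jv l)))) ≠ pm (ω 0 i)) :
    1 ≤ Real.exp (-t * (N : ℝ) ^ k) *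
      ∏ μ : Fin m, gE t k i (fun j => ω 0 j == ω μ.succ j) := by
  have hN : (0 : ℝ) < N := by exact_mod_cast Nat.pos_of_ne_zero (NeZero.ne N)
  have h := sign_ne H
  rw [hop_field k (fun μ j => pm (ω μ j)) (fun j => pm (ω 0 j)) i, Fin.sum_univ_succ,
    mul_left_comm] at h
  have h2 := nonpos_of_mul_nonpos_right h (by positivity)
  simp only [pm_sq, mul_add, ← mul_assoc, Finset.mul_sum, Finset.sum_const, Finset.card_univ,
    Fintype.card_fin, nsmul_eq_mul, mul_one, one_mul] at h2
  simp only [gE, ← pm_mul]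
  rw [← Real.exp_sum, ← Real.exp_add]
  apply Real.one_le_exp
  simp only [mul_assoc (-t), ← Finset.mul_sum]
  rw [← mul_add]
  nlinarith

lemma sum_omega {m N : ℕ} (F : (Fin N → Bool) → ℝ) :
    ∑ ω : Fin (m + 1) → Fin N → Bool, ∏ μ : Fin m, F (fun j => ω 0 j == ω μ.succ j) =
      (Fintype.card (Fin N → Bool) : ℝ) * (∑ x, F x) ^ m := by
  rw [← Equiv.sum_comp (Fin.consEquiv (fun _ : Fin (m + 1) => Fin N → Bool)),
    Fintype.sum_prod_type]
  simp only [Fin.consEquiv, Equiv.coe_fn_mk, Fin.cons_zero, Fin.cons_succ]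
  have : ∀ a : Fin N → Bool, ∑ p : Fin m → Fin N → Bool, ∏ μ, F (fun j => a j == p μ j) =
      (∑ x, F x) ^ m := by
    intro a
    rw [← sum_xnor a F, Fintype.sum_pow]
  simp only [this]
  simp

/-- Exponential Chebyshev (Markov) bound in the `n`-spin generalized Hopfield model with
`N` neurons and `M` i.i.d. uniform patterns: for every `t > 0`,
`P(∃ i : T̂_i(ξ^1) ≠ ξ^1_i)
   ≤ N · exp(−t N^{n-1}) · E[exp(−t ξ^1_1 ξ^2_1 (Σ_j ξ^1_j ξ^2_j)^{n-1})]^{M-1}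
   ≤ N · exp(−t N^{n-1}) · E[cosh(t (Σ_j ξ^1_j ξ^2_j)^{n-1})]^{M-1}`. -/
theorem nspin_hopfield_exponential_chebyshev (n N M : ℕ) (hn : 2 ≤ n)
    [NeZero N] [NeZero M] (t : ℝ) (ht : 0 < t) :
    unifProb (Ω := Fin M → Fin N → Bool)
        (fun ω => ∃ i : Fin N,
          hopT n (fun ν j => pm (ω ν j)) (fun j => pm (ω 0 j)) i ≠ pm (ω 0 i))
      ≤ (N : ℝ) * Real.exp (-t * (N : ℝ) ^ (n - 1)) *
          (expect2 N (fun a b =>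
            Real.exp (-t * (pm (a 0) * pm (b 0)) *
              (∑ j, pm (a j) * pm (b j)) ^ (n - 1)))) ^ (M - 1)
    ∧ (N : ℝ) * Real.exp (-t * (N : ℝ) ^ (n - 1)) *
          (expect2 N (fun a b =>
            Real.exp (-t * (pm (a 0) * pm (b 0)) *
              (∑ j, pm (a j) * pm (b j)) ^ (n - 1)))) ^ (M - 1)
      ≤ (N : ℝ) * Real.exp (-t * (N : ℝ) ^ (n - 1)) *
          (expect2 N (fun a b =>
            Real.cosh (t * (∑ j, pm (a j) * pm (b j)) ^ (n - 1)))) ^ (M - 1) := by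
  have e1 : expect2 N (fun a b =>
            Real.exp (-t * (pm (a 0) * pm (b 0)) *
              (∑ j, pm (a j) * pm (b j)) ^ (n - 1))) =
      (∑ x : Fin N → Bool, gE t (n - 1) 0 x) / (Fintype.card (Fin N → Bool) : ℝ) := by
    rw [← expect2_eq]; simp only [gE, pm_mul]
  have e2 : expect2 N (fun a b =>
            Real.cosh (t * (∑ j, pm (a j) * pm (b j)) ^ (n - 1))) =
      (∑ x : Fin N → Bool, Real.cosh (t * (∑ j, pm (x j)) ^ (n - 1))) /
        (Fintype.card (Fin N → Bool) : ℝ) := by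
    rw [← expect2_eq]; simp only [pm_mul]
  have hg : ∀ i x, 0 ≤ gE (N := N) t (n - 1) i x := fun i x => (Real.exp_pos _).le
  rw [e1, e2]
  constructor
  · obtain ⟨m, rfl⟩ := Nat.exists_eq_succ_of_ne_zero (NeZero.ne M)
    classical
    simp only [Nat.succ_eq_add_one, Nat.add_sub_cancel]
    unfold unifProb
    have hc : (0 : ℝ) < Fintype.card (Fin N → Bool) := by positivity
    have hcard : (Fintype.card (Fin (m + 1) → Fin N → Bool) : ℝ) =
        (Fintype.card (Fin N → Bool) : ℝ) * (Fintype.card (Fin N → Bool) : ℝ) ^ m := by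
      rw [Fintype.card_fun, Fintype.card_fin]; push_cast; ring
    have hC := hcard
    rw [div_le_iff₀ (by positivity), hC, Finset.card_filter]
    push_cast
    calc _ ≤ ∑ ω : Fin (m + 1) → Fin N → Bool, ∑ i : Fin N,
          Real.exp (-t * (N : ℝ) ^ (n - 1)) *
            ∏ μ : Fin m, gE t (n - 1) i (fun j => ω 0 j == ω μ.succ j) := by
          refine Finset.sum_le_sum fun ω _ => ?_
          have hpos : ∀ i : Fin N, 0 ≤ Real.exp (-t * (N : ℝ) ^ (n - 1)) *
            ∏ μ : Fin m, gE t (n - 1) i (fun j => ω 0 j == ω μ.succ j) := fun i =>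
              mul_nonneg (Real.exp_pos _).le (Finset.prod_nonneg fun μ _ => hg _ _)
          split_ifs with hE
          · obtain ⟨i, hi⟩ := hE
            exact (event_le (n - 1) t ht ω i hi).trans
              (Finset.single_le_sum (fun i _ => hpos i) (Finset.mem_univ i))
          · exact Finset.sum_nonneg fun i _ => hpos i
      _ = (N : ℝ) * Real.exp (-t * (N : ℝ) ^ (n - 1)) *
          ((Fintype.card (Fin N → Bool) : ℝ) *
            (∑ x : Fin N → Bool, gE t (n - 1) 0 x) ^ m) := by
          rw [Finset.sum_comm]
          simp only [← Finset.mul_sum, sum_omega]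
          rw [Finset.sum_congr rfl fun i _ => by rw [gE_sym t (n - 1) i 0]]
          simp only [Finset.sum_const, Finset.card_univ, Fintype.card_fin, nsmul_eq_mul]
          ring
      _ ≤ _ := by
          apply le_of_eq
          rw [div_pow]
          have := pow_pos hc m
          generalize (Fintype.card (Fin N → Bool) : ℝ) = c at *
          field_simp
  · have := sum_gE_le (N := N) t ht (n - 1)
    have h0 : 0 ≤ ∑ x : Fin N → Bool, gE t (n - 1) 0 x := Finset.sum_nonneg fun x _ => hg _ _
    gcongr
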